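/- Let λ be a partition with at most n parts and m₀ the number of zero parts of λ. Then ⟨E_λ^{(n)}(z;c,d), z^λ⟩₀ = ∏_{i=0}^{m₀−1} [(1−t^i ac)(1−t^i bc)(1−t^i cd)(1−t^i ad)(1−t^i bd)]^{−1} · ∏_{j=m₀−1}^{2m₀−2} (1−t^j abcd). -/

import Mathlib

open Finset MeasureTheory

/-- `lam` is a partition: weakly decreasing with nonnegative entries. -/
def isPartition {n : ℕ} (lam : Fin n → ℤ) : Prop :=
  (∀ i, 0 ≤ lam i) ∧ ∀ i j : Fin n, i ≤ j → lam j ≤ lam i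

/-- Normalized integral over the `n`-torus against Haar measure. -/
noncomputable def torusInt (n : ℕ) (f : (Fin n → ℂ) → ℂ) : ℂ :=
  ((2 * Real.pi : ℂ))⁻¹ ^ n *
    ∫ θ : Fin n → ℝ in Set.univ.pi fun _ : Fin n => Set.Ioc (0 : ℝ) (2 * Real.pi),
      f fun i => Complex.exp (Complex.I * θ i)

/-- The `q = 0` nonsymmetric Koornwinder density `Δ_K^{(n)}(z;t;a,b,c,d)`. -/
noncomputable def nsDensity (n : ℕ) (t a b c d : ℂ) (z : Fin n → ℂ) : ℂ :=
  (∏ i : Fin n, (1 - z i ^ 2) /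
      ((1 - a * z i) * (1 - b * z i) * (1 - c * z i) * (1 - d * z i) *
        (1 - c * (z i)⁻¹) * (1 - d * (z i)⁻¹))) *
  ∏ i : Fin n, ∏ j : Fin n,
    if i < j then
      ((1 - z i * z j) * (1 - z i * (z j)⁻¹)) /
        ((1 - t * z i * z j) * (1 - t * z i * (z j)⁻¹))
    else 1

/-- The nonsymmetric polynomial `E_λ^{(n)}(z;c,d) = ∏_{λ_i>0} z_i^{λ_i}(1−cz_i⁻¹)(1−dz_i⁻¹)`. -/
noncomputable def Epoly (n : ℕ) (lam : Fin n → ℤ) (c d : ℂ) (z : Fin n → ℂ) : ℂ :=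
  ∏ i ∈ Finset.univ.filter fun i : Fin n => 0 < lam i,
    z i ^ lam i * (1 - c * (z i)⁻¹) * (1 - d * (z i)⁻¹)


/-- The closed form of the total mass of the nonsymmetric density in `n` variables. -/
noncomputable def massFormula (n : ℕ) (t a b c d : ℂ) : ℂ :=
  (∏ i ∈ range n, ((1 - t ^ i * a * c) * (1 - t ^ i * b * c) * (1 - t ^ i * c * d) *
      (1 - t ^ i * a * d) * (1 - t ^ i * b * d)))⁻¹ *
    ∏ j ∈ Ico (n - 1) (2 * n - 1), (1 - t ^ j * a * b * c * d)

/-- The factor of the density coupling one variable `w` to all the variables `z`. -/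
noncomputable def crossFactor {n : ℕ} (t w : ℂ) (z : Fin n → ℂ) : ℂ :=
  ∏ j : Fin n, ((1 - w * z j) * (1 - w * (z j)⁻¹)) / ((1 - t * w * z j) * (1 - t * w * (z j)⁻¹))

section Norms

lemma one_sub_ne_zero_of_norm_lt_one {u : ℂ} (hu : ‖u‖ < 1) : 1 - u ≠ 0 := by
  intro h
  rw [← sub_eq_zero.mp h, norm_one] at hu
  exact lt_irrefl _ hu

lemma norm_mul_lt_one {u v : ℂ} (hu : ‖u‖ < 1) (hv : ‖v‖ ≤ 1) : ‖u * v‖ < 1 := by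
  rw [norm_mul]
  exact mul_lt_one_of_nonneg_of_lt_one_left (norm_nonneg _) hu hv

lemma one_sub_mul_ne_zero {u v : ℂ} (hu : ‖u‖ < 1) (hv : ‖v‖ ≤ 1) : 1 - u * v ≠ 0 :=
  one_sub_ne_zero_of_norm_lt_one (norm_mul_lt_one hu hv)

lemma one_sub_pow_mul_ne_zero {t u : ℂ} (ht : ‖t‖ < 1) (hu : ‖u‖ < 1) (i : ℕ) :
    1 - t ^ i * u ≠ 0 := by
  rw [mul_comm]
  exact one_sub_mul_ne_zero hu (by rw [norm_pow]; exact pow_le_one₀ (norm_nonneg _) ht.le)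

lemma ne_zero_of_norm_eq_one {u : ℂ} (hu : ‖u‖ = 1) : u ≠ 0 := by
  rw [← norm_pos_iff, hu]; exact one_pos

lemma norm_inv_le_one {u : ℂ} (hu : ‖u‖ = 1) : ‖u⁻¹‖ ≤ 1 := by rw [norm_inv, hu, inv_one]

lemma norm_exp_I_mul (x : ℝ) : ‖Complex.exp (Complex.I * x)‖ = 1 := by
  rw [mul_comm, Complex.norm_exp_ofReal_mul_I]

end Norms

section ClosedForm

lemma prod_one_sub_pow_shift {t x : ℂ} (n : ℕ) :
    (1 - x) * ∏ i ∈ range n, (1 - t ^ i * (t * x)) =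
      (∏ i ∈ range n, (1 - t ^ i * x)) * (1 - t ^ n * x) := by
  rw [← prod_range_succ (fun i => 1 - t ^ i * x), prod_range_succ', mul_comm]
  simp only [pow_zero, one_mul, pow_succ, mul_assoc]

lemma prod_Ico_one_sub_pow_shift {t x : ℂ} (n : ℕ) :
    (∏ j ∈ Ico (n - 1) (2 * n - 1), (1 - t ^ j * (t * x))) * (1 - t ^ (2 * n) * x) =
      ∏ j ∈ Ico (n + 1 - 1) (2 * (n + 1) - 1), (1 - t ^ j * x) := by
  cases n with
  | zero => simp
  | succ k =>
    have h₁ : 2 * (k + 1 + 1) - 1 = 2 * k + 1 + 1 + 1 := by omega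
    have h₂ : 2 * (k + 1) - 1 = 2 * k + 1 := by omega
    have h₃ : 2 * (k + 1) = 2 * k + 1 + 1 := by omega
    rw [h₁, h₂, h₃, prod_Ico_succ_top (b := 2 * k + 1 + 1) (by omega), Nat.add_sub_cancel, Nat.add_sub_cancel,
      ← prod_Ico_add' (fun j => 1 - t ^ j * x) k (2 * k + 1) 1]
    simp only [pow_succ, mul_assoc]

lemma massFormula_eq (n : ℕ) (t a b c d : ℂ) :
    massFormula n t a b c d =
      ((∏ i ∈ range n, (1 - t ^ i * (a * c))) * (∏ i ∈ range n, (1 - t ^ i * (b * c))) *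
        (∏ i ∈ range n, (1 - t ^ i * (c * d))) * (∏ i ∈ range n, (1 - t ^ i * (a * d))) *
        (∏ i ∈ range n, (1 - t ^ i * (b * d))))⁻¹ *
      ∏ j ∈ Ico (n - 1) (2 * n - 1), (1 - t ^ j * (a * b * c * d)) := by
  simp only [massFormula, prod_mul_distrib, mul_assoc]

lemma massFormula_recursion (n : ℕ) {t a b c d : ℂ} (ha : ‖a‖ < 1) (hb : ‖b‖ < 1) (hc : ‖c‖ < 1)
    (hd : ‖d‖ < 1) (ht : ‖t‖ < 1) (hcd : c ≠ d) :
    (c * (massFormula n t a b (t * c) d / ((1 - a * c) * (1 - b * c) * (1 - c * d))) -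
      d * (massFormula n t a b c (t * d) / ((1 - a * d) * (1 - b * d) * (1 - c * d)))) / (c - d) =
    massFormula (n + 1) t a b c d := by
  have hac := norm_mul_lt_one ha hc.le
  have hbc := norm_mul_lt_one hb hc.le
  have hcd' := norm_mul_lt_one hc hd.le
  have had := norm_mul_lt_one ha hd.le
  have hbd := norm_mul_lt_one hb hd.le
  have key : ∀ {x : ℂ}, ‖x‖ < 1 → ∏ i ∈ range n, (1 - t ^ i * (t * x)) =
      (∏ i ∈ range n, (1 - t ^ i * x)) * (1 - t ^ n * x) / (1 - x) := by
    intro x hx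
    rw [eq_div_iff (one_sub_ne_zero_of_norm_lt_one hx), mul_comm, prod_one_sub_pow_shift]
  have nz : ∀ {x : ℂ}, ‖x‖ < 1 → ∏ i ∈ range n, (1 - t ^ i * x) ≠ 0 := fun hx =>
    prod_ne_zero_iff.mpr fun i _ => one_sub_pow_mul_ne_zero ht hx i
  have nac := nz hac
  have nbc := nz hbc
  have ncd := nz hcd'
  have nad := nz had
  have nbd := nz hbd
  have mac := one_sub_pow_mul_ne_zero ht hac n
  have mbc := one_sub_pow_mul_ne_zero ht hbc n
  have mcd := one_sub_pow_mul_ne_zero ht hcd' n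
  have mad := one_sub_pow_mul_ne_zero ht had n
  have mbd := one_sub_pow_mul_ne_zero ht hbd n
  have oac := one_sub_ne_zero_of_norm_lt_one hac
  have obc := one_sub_ne_zero_of_norm_lt_one hbc
  have ocd := one_sub_ne_zero_of_norm_lt_one hcd'
  have oad := one_sub_ne_zero_of_norm_lt_one had
  have obd := one_sub_ne_zero_of_norm_lt_one hbd
  have hsub : c - d ≠ 0 := sub_ne_zero.mpr hcd
  simp only [massFormula_eq, prod_range_succ _ n]
  rw [← prod_Ico_one_sub_pow_shift,
    show a * (t * c) = t * (a * c) by ring, show b * (t * c) = t * (b * c) by ring,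
    show t * c * d = t * (c * d) by ring,
    show a * b * (t * c) * d = t * (a * b * c * d) by ring,
    show a * (t * d) = t * (a * d) by ring, show b * (t * d) = t * (b * d) by ring,
    show c * (t * d) = t * (c * d) by ring, show a * b * c * (t * d) = t * (a * b * c * d) by ring,
    key hac, key hbc, key hcd', key had, key hbd]
  generalize ∏ i ∈ range n, (1 - t ^ i * (a * c)) = Pac at *
  generalize ∏ i ∈ range n, (1 - t ^ i * (b * c)) = Pbc at *
  generalize ∏ i ∈ range n, (1 - t ^ i * (c * d)) = Pcd at *
  generalize ∏ i ∈ range n, (1 - t ^ i * (a * d)) = Pad at *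
  generalize ∏ i ∈ range n, (1 - t ^ i * (b * d)) = Pbd at *
  generalize ∏ j ∈ Ico (n - 1) (2 * n - 1), (1 - t ^ j * (t * (a * b * c * d))) = M
  rw [show t ^ (2 * n) = t ^ n * t ^ n by ring]
  generalize t ^ n = s at *
  have hfin : 1 - s * s * (a * b * c * d) = (c * (1 - s * (a * d)) * (1 - s * (b * d)) -
      d * (1 - s * (a * c)) * (1 - s * (b * c))) / (c - d) := by
    rw [eq_div_iff hsub]
    ring
  rw [hfin]
  generalize 1 - s * (a * c) = Sac at *
  generalize 1 - s * (b * c) = Sbc at *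
  generalize 1 - s * (c * d) = Scd at *
  generalize 1 - s * (a * d) = Sad at *
  generalize 1 - s * (b * d) = Sbd at *
  generalize 1 - a * c = Oac at *
  generalize 1 - b * c = Obc at *
  generalize 1 - c * d = Ocd at *
  generalize 1 - a * d = Oad at *
  generalize 1 - b * d = Obd at *
  field_simp

end ClosedForm

section Torus

lemma torusInt_congr {n : ℕ} {f g : (Fin n → ℂ) → ℂ}
    (h : ∀ z : Fin n → ℂ, (∀ i, ‖z i‖ = 1) → f z = g z) : torusInt n f = torusInt n g := by
  unfold torusInt
  congr 1
  exact integral_congr_ae (Filter.Eventually.of_forall fun θ => h _ fun i => norm_exp_I_mul _)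

lemma torusInt_const_mul {n : ℕ} (k : ℂ) (f : (Fin n → ℂ) → ℂ) :
    torusInt n (fun z => k * f z) = k * torusInt n f := by
  simp only [torusInt, integral_const_mul]
  ring

lemma torusInt_zero (f : (Fin 0 → ℂ) → ℂ) : torusInt 0 f = f Fin.elim0 := by
  have : (volume : Measure (Fin 0 → ℝ)) = Measure.dirac Fin.elim0 := by
    rw [volume_pi, Measure.pi_of_empty _ Fin.elim0]
  have hbox : (Set.univ.pi fun _ : Fin 0 => Set.Ioc (0 : ℝ) (2 * Real.pi)) = Set.univ :=
    Set.eq_univ_of_forall fun _ i => i.elim0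
  rw [torusInt, hbox, Measure.restrict_univ, this, integral_dirac, pow_zero, one_mul]
  exact congrArg f (Subsingleton.elim _ _)

lemma circleAverage_zero_one (f : ℂ → ℂ) :
    Real.circleAverage f 0 1 =
      (2 * Real.pi : ℂ)⁻¹ * ∫ x in Set.Ioc (0 : ℝ) (2 * Real.pi), f (Complex.exp (Complex.I * x)) := by
  rw [Real.circleAverage_def, intervalIntegral.integral_of_le Real.two_pi_pos.le,
    Complex.real_smul]
  push_cast
  simp only [circleMap, zero_add, Complex.ofReal_one, one_mul, mul_comm Complex.I]

lemma integrableOn_box {n : ℕ} {f : (Fin n → ℝ) → ℂ} (hf : Continuous f) :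
    IntegrableOn f (Set.univ.pi fun _ : Fin n => Set.Ioc (0 : ℝ) (2 * Real.pi)) :=
  (hf.continuousOn.integrableOn_compact
    (isCompact_univ_pi fun _ => (isCompact_Icc : IsCompact (Set.Icc (0 : ℝ) (2 * Real.pi))))).mono_set
    (Set.pi_mono fun _ _ => Set.Ioc_subset_Icc_self)

/-- Integrating over the torus, the first variable first. -/
lemma torusInt_succ {n : ℕ} {f : (Fin (n + 1) → ℂ) → ℂ}
    (hf : Continuous fun θ : Fin (n + 1) → ℝ => f fun i => Complex.exp (Complex.I * θ i)) :
    torusInt (n + 1) f =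
      torusInt n fun z => Real.circleAverage (fun w => f (Fin.cons w z)) 0 1 := by
  set μ : Measure ℝ := volume.restrict (Set.Ioc (0 : ℝ) (2 * Real.pi)) with hμ
  have hbox : ∀ m : ℕ, (volume : Measure (Fin m → ℝ)).restrict
      (Set.univ.pi fun _ : Fin m => Set.Ioc (0 : ℝ) (2 * Real.pi)) =
      Measure.pi fun _ : Fin m => μ := fun m => by
    rw [volume_pi, Measure.restrict_pi_pi]
  have hint := integrableOn_box hf
  rw [IntegrableOn, hbox] at hint
  simp only [torusInt, circleAverage_zero_one, hbox, integral_const_mul]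
  rw [← mul_assoc, ← pow_succ]
  congr 1
  have hmp := (measurePreserving_piFinSuccAbove (fun _ : Fin (n + 1) => μ) 0).symm
  rw [← hmp.integral_comp' (g := fun θ : Fin (n + 1) → ℝ => f fun i => Complex.exp (Complex.I * θ i)),
    integral_prod_symm]
  · refine integral_congr_ae (Filter.Eventually.of_forall fun θ => ?_)
    refine integral_congr_ae (Filter.Eventually.of_forall fun x => ?_)
    simp only
    congr 1
    ext i
    refine Fin.cases ?_ (fun j => ?_) i <;> simp [MeasurableEquiv.piFinSuccAbove]
  · exact (hmp.integrable_comp_emb (MeasurableEquiv.measurableEmbedding _)).mpr hint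

end Torus

section Residues

variable {F : ℂ → ℂ} {c d : ℂ}

lemma closure_unit_ball : closure (Metric.ball (0 : ℂ) |1|) = Metric.closedBall 0 1 := by
  rw [abs_one, closure_ball _ one_ne_zero]

lemma circleAverage_of_differentiableOn (hF : DifferentiableOn ℂ F (Metric.closedBall 0 1)) :
    Real.circleAverage F 0 1 = F 0 :=
  DiffContOnCl.circleAverage (DifferentiableOn.diffContOnCl (by rwa [closure_unit_ball]))

lemma circleAverage_div_one_sub (hF : DifferentiableOn ℂ F (Metric.closedBall 0 1))
    (hc : ‖c‖ < 1) : Real.circleAverage (fun w => w / (w - c) * F w) 0 1 = F c := by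
  have := DiffContOnCl.circleAverage_smul_div (f := F) (c := 0) (R := 1) (w := c)
    (DifferentiableOn.diffContOnCl (by rwa [closure_unit_ball])) (by simpa using hc)
  simpa using this

lemma circleIntegrable_div_sub_mul (hF : DifferentiableOn ℂ F (Metric.closedBall 0 1))
    (hc : ‖c‖ < 1) : CircleIntegrable (fun w => w / (w - c) * F w) 0 1 := by
  refine ContinuousOn.circleIntegrable zero_le_one ?_
  refine ContinuousOn.mul (continuousOn_id.div (continuousOn_id.sub continuousOn_const) ?_)
    (hF.continuousOn.mono Metric.sphere_subset_closedBall)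
  intro w hw h
  have h₁ : ‖w‖ = 1 := by simpa using hw
  rw [sub_eq_zero.mp h] at h₁
  exact hc.ne h₁

/-- Residue evaluation with two simple poles `c`, `d` in the unit disc. -/
lemma circleAverage_two_poles (hF : DifferentiableOn ℂ F (Metric.closedBall 0 1))
    (hc : ‖c‖ < 1) (hd : ‖d‖ < 1) (hcd : c ≠ d) :
    Real.circleAverage (fun w => F w / ((1 - c * w⁻¹) * (1 - d * w⁻¹))) 0 1 =
      (c * F c - d * F d) / (c - d) := by
  have hsub : c - d ≠ 0 := sub_ne_zero.mpr hcd
  have h : Set.EqOn (fun w => F w / ((1 - c * w⁻¹) * (1 - d * w⁻¹)))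
      (fun w => (c - d)⁻¹ • (c • (w / (w - c) * F w) - d • (w / (w - d) * F w)))
      (Metric.sphere 0 |1|) := by
    intro w hw
    have h₁ : ‖w‖ = 1 := by simpa using hw
    have hw0 := ne_zero_of_norm_eq_one h₁
    have hwc : w - c ≠ 0 := fun h => by rw [sub_eq_zero.mp h] at h₁; exact hc.ne h₁
    have hwd : w - d ≠ 0 := fun h => by rw [sub_eq_zero.mp h] at h₁; exact hd.ne h₁
    have e : ∀ u : ℂ, 1 - u * w⁻¹ = (w - u) / w := fun u => by field_simp
    simp only [smul_eq_mul, e]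
    field_simp
    ring
  rw [Real.circleAverage_congr_sphere h, Real.circleAverage_fun_smul, Real.circleAverage_fun_sub,
    Real.circleAverage_fun_smul, Real.circleAverage_fun_smul, circleAverage_div_one_sub hF hc,
    circleAverage_div_one_sub hF hd, smul_eq_mul, smul_eq_mul, smul_eq_mul, inv_mul_eq_div]
  · exact (circleIntegrable_div_sub_mul hF hc).const_smul
  · exact (circleIntegrable_div_sub_mul hF hd).const_smul

end Residues

section Density

variable {n : ℕ} {t a b c d : ℂ} {z : Fin n → ℂ}

lemma nsDensity_swap (n : ℕ) (t a b c d : ℂ) (z : Fin n → ℂ) :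
    nsDensity n t a b c d z = nsDensity n t a b d c z := by
  unfold nsDensity
  congr 1
  refine prod_congr rfl fun i _ => ?_
  congr 1
  ring

lemma nsDensity_cons (t a b c d w : ℂ) (z : Fin n → ℂ) :
    nsDensity (n + 1) t a b c d (Fin.cons w z) =
      (1 - w ^ 2) / ((1 - a * w) * (1 - b * w) * (1 - c * w) * (1 - d * w) *
        (1 - c * w⁻¹) * (1 - d * w⁻¹)) * crossFactor t w z * nsDensity n t a b c d z := by
  simp only [nsDensity, crossFactor, Fin.prod_univ_succ, Fin.cons_zero, Fin.cons_succ,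
    if_false, one_mul, Fin.succ_lt_succ_iff, Fin.succ_pos, if_true, Fin.not_lt_zero]
  ring

lemma crossFactor_mul_nsDensity (a b d : ℂ) (hc : ‖c‖ < 1) (hz : ∀ i, ‖z i‖ = 1) :
    crossFactor t c z * nsDensity n t a b c d z = nsDensity n t a b (t * c) d z := by
  unfold crossFactor nsDensity
  rw [← mul_assoc, ← prod_mul_distrib]
  congr 1
  refine prod_congr rfl fun i _ => ?_
  have h₁ := one_sub_mul_ne_zero hc (hz i).le
  have h₂ := one_sub_mul_ne_zero hc (norm_inv_le_one (hz i))
  generalize (z i)⁻¹ = y at *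
  rw [div_mul_div_comm,
    show (1 - t * c * z i) * (1 - t * c * y) * ((1 - a * z i) * (1 - b * z i) * (1 - c * z i) *
      (1 - d * z i) * (1 - c * y) * (1 - d * y)) =
      ((1 - c * z i) * (1 - c * y)) * ((1 - a * z i) * (1 - b * z i) * (1 - t * c * z i) *
      (1 - d * z i) * (1 - t * c * y) * (1 - d * y)) by ring,
    mul_div_mul_left _ _ (mul_ne_zero h₁ h₂)]

lemma continuous_nsDensity {X : Type*} [TopologicalSpace X] {D : X → ℂ} {Z : X → Fin n → ℂ}
    (hD : Continuous D) (hZ : Continuous Z) (ha : ‖a‖ < 1) (hb : ‖b‖ < 1) (hc : ‖c‖ < 1)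
    (ht : ‖t‖ < 1) (hd : ∀ x, ‖D x‖ < 1) (hz : ∀ x i, ‖Z x i‖ = 1) :
    Continuous fun x => nsDensity n t a b c (D x) (Z x) := by
  have hZi : ∀ i, Continuous fun x => Z x i := fun i => (continuous_apply i).comp hZ
  have hZinv : ∀ i, Continuous fun x => (Z x i)⁻¹ := fun i =>
    (hZi i).inv₀ fun x => ne_zero_of_norm_eq_one (hz x i)
  unfold nsDensity
  refine (continuous_finsetProd _ fun i _ => ?_).mul
    (continuous_finsetProd _ fun i _ => continuous_finsetProd _ fun j _ => ?_)
  · have hi := hZi i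
    have hi' := hZinv i
    refine Continuous.div (by fun_prop) (by fun_prop) fun x => ?_
    have hx := (hz x i).le
    have hx' := norm_inv_le_one (hz x i)
    simp only [mul_ne_zero_iff]
    exact ⟨⟨⟨⟨⟨one_sub_mul_ne_zero ha hx, one_sub_mul_ne_zero hb hx⟩, one_sub_mul_ne_zero hc hx⟩,
      one_sub_mul_ne_zero (hd x) hx⟩, one_sub_mul_ne_zero hc hx'⟩, one_sub_mul_ne_zero (hd x) hx'⟩
  · split_ifs
    · have hi := hZi i
      have hj := hZi j
      have hj' := hZinv j
      refine Continuous.div (by fun_prop) (by fun_prop) fun x => ?_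
      have hx := norm_mul_lt_one ht (hz x i).le
      exact mul_ne_zero (one_sub_mul_ne_zero hx (hz x j).le)
        (one_sub_mul_ne_zero hx (norm_inv_le_one (hz x j)))
    · exact continuous_const

lemma differentiableOn_crossFactor (ht : ‖t‖ < 1) (hz : ∀ i, ‖z i‖ = 1) :
    DifferentiableOn ℂ (fun w => crossFactor t w z) (Metric.closedBall 0 1) := by
  unfold crossFactor
  refine DifferentiableOn.fun_finsetProd fun j _ => ?_
  refine DifferentiableOn.div (by fun_prop) (by fun_prop) fun w hw => ?_
  have hw' := norm_mul_lt_one ht (show ‖w‖ ≤ 1 by simpa using hw)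
  exact mul_ne_zero (one_sub_mul_ne_zero hw' (hz j).le)
    (one_sub_mul_ne_zero hw' (norm_inv_le_one (hz j)))

lemma differentiableOn_inv_factors (ha : ‖a‖ < 1) (hb : ‖b‖ < 1) (hc : ‖c‖ < 1) (hd : ‖d‖ < 1) :
    DifferentiableOn ℂ
      (fun w => (1 - w ^ 2) / ((1 - a * w) * (1 - b * w) * (1 - c * w) * (1 - d * w)))
      (Metric.closedBall 0 1) := by
  refine DifferentiableOn.div (by fun_prop) (by fun_prop) fun w hw => ?_
  have hw' : ‖w‖ ≤ 1 := by simpa using hw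
  simp only [mul_ne_zero_iff]
  exact ⟨⟨⟨one_sub_mul_ne_zero ha hw', one_sub_mul_ne_zero hb hw'⟩, one_sub_mul_ne_zero hc hw'⟩,
    one_sub_mul_ne_zero hd hw'⟩

/-- Integrating out the first variable of the density when it is a zero part. -/
lemma circleAverage_nsDensity_cons (ha : ‖a‖ < 1) (hb : ‖b‖ < 1) (hc : ‖c‖ < 1) (hd : ‖d‖ < 1)
    (ht : ‖t‖ < 1) (hcd : c ≠ d) (hz : ∀ i, ‖z i‖ = 1) :
    Real.circleAverage (fun w => nsDensity (n + 1) t a b c d (Fin.cons w z)) 0 1 =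
      (c * (nsDensity n t a b (t * c) d z / ((1 - a * c) * (1 - b * c) * (1 - c * d))) -
        d * (nsDensity n t a b c (t * d) z / ((1 - a * d) * (1 - b * d) * (1 - c * d)))) /
          (c - d) := by
  have hF := ((differentiableOn_inv_factors ha hb hc hd).mul
    (differentiableOn_crossFactor ht hz)).mul_const (nsDensity n t a b c d z)
  have key := circleAverage_two_poles hF hc hd hcd
  have hcc : 1 - c ^ 2 ≠ 0 := by rw [sq]; exact one_sub_mul_ne_zero hc hc.le
  have hdd : 1 - d ^ 2 ≠ 0 := by rw [sq]; exact one_sub_mul_ne_zero hd hd.le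
  have e : ∀ A B x y N : ℂ, N ≠ 0 → N / (A * B * N * x) * y = y / (A * B * x) := by
    intro A B x y N hN
    rw [show A * B * N * x = N * (A * B * x) by ring, div_mul_eq_mul_div, mul_div_mul_left _ _ hN]
  have hl : (fun w => nsDensity (n + 1) t a b c d (Fin.cons w z)) = fun w =>
      ((1 - w ^ 2) / ((1 - a * w) * (1 - b * w) * (1 - c * w) * (1 - d * w)) *
        crossFactor t w z * nsDensity n t a b c d z) / ((1 - c * w⁻¹) * (1 - d * w⁻¹)) := by
    ext w
    rw [nsDensity_cons, mul_div_right_comm, mul_div_right_comm, div_div]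
    simp only [mul_assoc]
  rw [hl]
  refine key.trans ?_
  simp only [Pi.mul_apply]
  rw [mul_assoc (_ / _) (crossFactor t c z), crossFactor_mul_nsDensity a b d hc hz,
    mul_assoc (_ / _) (crossFactor t d z), nsDensity_swap n t a b c d,
    crossFactor_mul_nsDensity a b c hd hz, nsDensity_swap n t a b (t * d) c,
    show (1 - a * c) * (1 - b * c) * (1 - c * c) * (1 - d * c) =
      (1 - a * c) * (1 - b * c) * (1 - c ^ 2) * (1 - c * d) by ring,
    show (1 - a * d) * (1 - b * d) * (1 - c * d) * (1 - d * d) =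
      (1 - a * d) * (1 - b * d) * (1 - d ^ 2) * (1 - c * d) by ring,
    e _ _ _ _ _ hcc, e _ _ _ _ _ hdd]

lemma continuous_exp_pi : Continuous fun (θ : Fin n → ℝ) (i : Fin n) =>
    Complex.exp (Complex.I * θ i) := by
  fun_prop

lemma torusInt_sub {f g : (Fin n → ℂ) → ℂ}
    (hf : Continuous fun θ : Fin n → ℝ => f fun i => Complex.exp (Complex.I * θ i))
    (hg : Continuous fun θ : Fin n → ℝ => g fun i => Complex.exp (Complex.I * θ i)) :
    torusInt n (fun z => f z - g z) = torusInt n f - torusInt n g := by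
  simp only [torusInt]
  rw [integral_sub (integrableOn_box hf) (integrableOn_box hg), mul_sub]

lemma torusInt_nsDensity_succ (ha : ‖a‖ < 1) (hb : ‖b‖ < 1) (hc : ‖c‖ < 1) (hd : ‖d‖ < 1)
    (ht : ‖t‖ < 1) (hcd : c ≠ d) :
    torusInt (n + 1) (nsDensity (n + 1) t a b c d) =
      (c * (torusInt n (nsDensity n t a b (t * c) d) /
          ((1 - a * c) * (1 - b * c) * (1 - c * d))) -
        d * (torusInt n (nsDensity n t a b c (t * d)) /
          ((1 - a * d) * (1 - b * d) * (1 - c * d)))) / (c - d) := by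
  have hcont : ∀ (m : ℕ) {c d : ℂ}, ‖c‖ < 1 → ‖d‖ < 1 → Continuous fun θ : Fin m → ℝ =>
      nsDensity m t a b c d fun i => Complex.exp (Complex.I * θ i) := fun m _ _ hc hd =>
    continuous_nsDensity continuous_const continuous_exp_pi ha hb hc ht (fun _ => hd)
      fun _ _ => norm_exp_I_mul _
  have h₁ := hcont n (norm_mul_lt_one ht hc.le) hd
  have h₂ := hcont n hc (norm_mul_lt_one ht hd.le)
  rw [torusInt_succ (hcont (n + 1) hc hd),
    torusInt_congr fun z hz => circleAverage_nsDensity_cons ha hb hc hd ht hcd hz]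
  have hlin : (fun z : Fin n → ℂ =>
      (c * (nsDensity n t a b (t * c) d z / ((1 - a * c) * (1 - b * c) * (1 - c * d))) -
        d * (nsDensity n t a b c (t * d) z / ((1 - a * d) * (1 - b * d) * (1 - c * d)))) /
          (c - d)) = fun z =>
      c / ((1 - a * c) * (1 - b * c) * (1 - c * d)) / (c - d) * nsDensity n t a b (t * c) d z -
        d / ((1 - a * d) * (1 - b * d) * (1 - c * d)) / (c - d) *
          nsDensity n t a b c (t * d) z := by
    ext z
    ring
  rw [hlin, torusInt_sub (continuous_const.mul h₁) (continuous_const.mul h₂),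
    torusInt_const_mul, torusInt_const_mul]
  ring

lemma continuousOn_torusInt_nsDensity (n : ℕ) (ha : ‖a‖ < 1) (hb : ‖b‖ < 1) (hc : ‖c‖ < 1)
    (ht : ‖t‖ < 1) :
    ContinuousOn (fun d => torusInt n (nsDensity n t a b c d)) (Metric.ball 0 1) := by
  rw [continuousOn_iff_continuous_domRestrict]
  have hloc : LocallyCompactSpace (Metric.ball (0 : ℂ) 1) :=
    Metric.isOpen_ball.locallyCompactSpace
  have hbox : (Set.univ.pi fun _ : Fin n => Set.Ioc (0 : ℝ) (2 * Real.pi)) =ᵐ[volume]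
      Set.Icc (fun _ => 0) fun _ => 2 * Real.pi := Measure.univ_pi_Ioc_ae_eq_Icc
  have hcont := continuous_parametric_integral_of_continuous (μ := (volume : Measure (Fin n → ℝ)))
    (f := fun (d : Metric.ball (0 : ℂ) 1) (θ : Fin n → ℝ) =>
      nsDensity n t a b c d fun i => Complex.exp (Complex.I * θ i))
    (continuous_nsDensity (continuous_subtype_val.comp continuous_fst)
      (continuous_exp_pi.comp continuous_snd) ha hb hc ht
      (fun x => mem_ball_zero_iff.mp x.1.2) fun _ _ => norm_exp_I_mul _)
    (isCompact_Icc (a := fun _ => (0 : ℝ)) (b := fun _ => 2 * Real.pi))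
  refine (hcont.const_mul ((2 * Real.pi : ℂ)⁻¹ ^ n)).congr fun d => ?_
  simp only [Set.domRestrict_apply, torusInt, setIntegral_congr_set hbox]

lemma continuousOn_massFormula (n : ℕ) (ha : ‖a‖ < 1) (hb : ‖b‖ < 1) (hc : ‖c‖ < 1)
    (ht : ‖t‖ < 1) : ContinuousOn (massFormula n t a b c) (Metric.ball 0 1) := by
  unfold massFormula
  refine ContinuousOn.mul (ContinuousOn.inv₀ (by fun_prop) fun d hd => ?_) (by fun_prop)
  have hd' : ‖d‖ < 1 := by simpa using hd
  have key : ∀ {x y : ℂ} (i : ℕ), ‖x‖ < 1 → ‖y‖ < 1 → 1 - t ^ i * x * y ≠ 0 := fun i hx hy => by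
    rw [mul_assoc]
    exact one_sub_pow_mul_ne_zero ht (norm_mul_lt_one hx hy.le) i
  refine prod_ne_zero_iff.mpr fun i _ => ?_
  simp only [mul_ne_zero_iff]
  exact ⟨⟨⟨⟨key i ha hc, key i hb hc⟩, key i hc hd'⟩, key i ha hd'⟩, key i hb hd'⟩

/-- The total mass of the nonsymmetric density. -/
lemma torusInt_nsDensity (n : ℕ) (ha : ‖a‖ < 1) (hb : ‖b‖ < 1) (ht : ‖t‖ < 1) :
    ∀ {c d : ℂ}, ‖c‖ < 1 → ‖d‖ < 1 →
      torusInt n (nsDensity n t a b c d) = massFormula n t a b c d := by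
  induction n with
  | zero =>
    intro c d _ _
    simp [torusInt_zero, nsDensity, massFormula]
  | succ n ih =>
    have generic : ∀ {c d : ℂ}, ‖c‖ < 1 → ‖d‖ < 1 → c ≠ d →
        torusInt (n + 1) (nsDensity (n + 1) t a b c d) = massFormula (n + 1) t a b c d := by
      intro c d hc hd hcd
      rw [torusInt_nsDensity_succ ha hb hc hd ht hcd, ih (norm_mul_lt_one ht hc.le) hd,
        ih hc (norm_mul_lt_one ht hd.le), massFormula_recursion n ha hb hc hd ht hcd]
    intro c d hc hd
    by_cases hcd : c = d
    · subst hcd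
      have hnhds : Metric.ball (0 : ℂ) 1 ∈ nhds c :=
        Metric.isOpen_ball.mem_nhds (by simpa using hc)
      have h₁ := (continuousOn_torusInt_nsDensity (n + 1) ha hb hc ht).continuousAt hnhds
      have h₂ := (continuousOn_massFormula (n + 1) ha hb hc ht).continuousAt hnhds
      refine ((h₁.eventuallyEq_nhds_iff_eventuallyEq_nhdsNE h₂).mp ?_).eq_of_nhds
      filter_upwards [mem_nhdsWithin_of_mem_nhds hnhds, self_mem_nhdsWithin] with e he hne
      exact generic hc (by simpa using he) (Ne.symm hne)
    · exact generic hc hd hcd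

end Density

section PositiveParts

variable {n : ℕ} {t a b c d : ℂ}

/-- The integrand of the norm evaluation. -/
noncomputable def normIntegrand (n : ℕ) (lam : Fin n → ℤ) (t a b c d : ℂ) (z : Fin n → ℂ) : ℂ :=
  Epoly n lam c d z * (∏ i : Fin n, z i ^ (-lam i)) * nsDensity n t a b c d z

lemma Epoly_mul_monomial (lam : Fin n → ℤ) (c d : ℂ) (hlam : ∀ i, 0 ≤ lam i) {z : Fin n → ℂ}
    (hz : ∀ i, ‖z i‖ = 1) :
    Epoly n lam c d z * ∏ i : Fin n, z i ^ (-lam i) =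
      ∏ i : Fin n, if 0 < lam i then (1 - c * (z i)⁻¹) * (1 - d * (z i)⁻¹) else 1 := by
  rw [Epoly, prod_filter, ← prod_mul_distrib]
  refine prod_congr rfl fun i _ => ?_
  have hzi := ne_zero_of_norm_eq_one (hz i)
  split_ifs with h
  · rw [zpow_neg]
    have := zpow_ne_zero (lam i) hzi
    field_simp
  · rw [show lam i = 0 from le_antisymm (not_lt.mp h) (hlam i)]
    simp

lemma continuous_normIntegrand (lam : Fin n → ℤ) (hlam : ∀ i, 0 ≤ lam i) (ha : ‖a‖ < 1)
    (hb : ‖b‖ < 1) (hc : ‖c‖ < 1) (hd : ‖d‖ < 1) (ht : ‖t‖ < 1) :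
    Continuous fun θ : Fin n → ℝ =>
      normIntegrand n lam t a b c d fun i => Complex.exp (Complex.I * θ i) := by
  unfold normIntegrand
  simp only [Epoly_mul_monomial lam c d hlam fun i => norm_exp_I_mul _]
  refine Continuous.mul (continuous_finsetProd _ fun i _ => ?_)
    (continuous_nsDensity continuous_const continuous_exp_pi ha hb hc ht (fun _ => hd)
      fun _ _ => norm_exp_I_mul _)
  have hinv : Continuous fun θ : Fin n → ℝ => (Complex.exp (Complex.I * θ i))⁻¹ :=
    Continuous.inv₀ (by fun_prop) fun _ => Complex.exp_ne_zero _
  split_ifs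
  · fun_prop
  · exact continuous_const

/-- Integrating out a variable that carries a positive part. -/
lemma circleAverage_normIntegrand_cons (lam : Fin (n + 1) → ℤ) (hlam : ∀ i, 0 ≤ lam i)
    (h0 : 0 < lam 0) (ha : ‖a‖ < 1) (hb : ‖b‖ < 1) (hc : ‖c‖ < 1) (hd : ‖d‖ < 1) (ht : ‖t‖ < 1)
    {z : Fin n → ℂ} (hz : ∀ i, ‖z i‖ = 1) :
    Real.circleAverage (fun w => normIntegrand (n + 1) lam t a b c d (Fin.cons w z)) 0 1 =
      normIntegrand n (Fin.tail lam) t a b c d z := by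
  have hF := ((differentiableOn_inv_factors ha hb hc hd).mul
    (differentiableOn_crossFactor ht hz)).mul_const (normIntegrand n (Fin.tail lam) t a b c d z)
  have hcongr : Set.EqOn (fun w => normIntegrand (n + 1) lam t a b c d (Fin.cons w z))
      (fun w => (1 - w ^ 2) / ((1 - a * w) * (1 - b * w) * (1 - c * w) * (1 - d * w)) *
        crossFactor t w z * normIntegrand n (Fin.tail lam) t a b c d z)
      (Metric.sphere 0 |1|) := by
    intro w hw
    have hw1 : ‖w‖ = 1 := by simpa using hw
    have hcons : ∀ i, ‖(Fin.cons w z : Fin (n + 1) → ℂ) i‖ = 1 :=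
      Fin.cases (by simpa using hw1) fun j => by simpa using hz j
    have h₁ := one_sub_mul_ne_zero hc (norm_inv_le_one hw1)
    have h₂ := one_sub_mul_ne_zero hd (norm_inv_le_one hw1)
    simp only [normIntegrand]
    rw [Epoly_mul_monomial lam c d hlam hcons,
      Epoly_mul_monomial (Fin.tail lam) c d (fun i => hlam _) hz, nsDensity_cons,
      Fin.prod_univ_succ]
    simp only [Fin.cons_zero, Fin.cons_succ, h0, if_true, Fin.tail]
    have e : ∀ N A p q x y v : ℂ, p ≠ 0 → q ≠ 0 →
        p * q * y * (N / (A * p * q) * x * v) = N / A * x * (y * v) := by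
      intro N A p q x y v hp hq
      field_simp
    exact e _ _ _ _ _ _ _ h₁ h₂
  rw [Real.circleAverage_congr_sphere hcongr]
  refine (circleAverage_of_differentiableOn hF).trans ?_
  simp [crossFactor]

end PositiveParts

/-- Norm evaluation: for a partition `λ` with `m₀` zero parts,
`⟨E_λ^{(n)}(z;c,d), z^λ⟩₀ = ∏_{i=0}^{m₀−1}[(1−tⁱac)(1−tⁱbc)(1−tⁱcd)(1−tⁱad)(1−tⁱbd)]⁻¹
  · ∏_{j=m₀−1}^{2m₀−2}(1−tʲabcd)`. -/
theorem E_norm_evaluation (n : ℕ) (lam : Fin n → ℤ) (hlam : isPartition lam)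
    (a b c d t : ℂ)
    (ha : ‖a‖ < 1) (hb : ‖b‖ < 1) (hc : ‖c‖ < 1) (hd : ‖d‖ < 1) (ht : ‖t‖ < 1) :
    torusInt n (fun z =>
      Epoly n lam c d z * (∏ i : Fin n, z i ^ (-lam i)) * nsDensity n t a b c d z)
    = (∏ i ∈ Finset.range ((Finset.univ.filter fun i : Fin n => lam i = 0).card),
        ((1 - t ^ i * a * c) * (1 - t ^ i * b * c) * (1 - t ^ i * c * d) *
         (1 - t ^ i * a * d) * (1 - t ^ i * b * d)))⁻¹ *
      ∏ j ∈ Finset.Ico ((Finset.univ.filter fun i : Fin n => lam i = 0).card - 1)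
          (2 * (Finset.univ.filter fun i : Fin n => lam i = 0).card - 1),
        (1 - t ^ j * a * b * c * d) := by
  change torusInt n (normIntegrand n lam t a b c d) = massFormula _ t a b c d
  induction n with
  | zero => simp [torusInt_zero, normIntegrand, Epoly, nsDensity, massFormula]
  | succ n ih =>
    by_cases h0 : 0 < lam 0
    · rw [torusInt_succ (continuous_normIntegrand lam hlam.1 ha hb hc hd ht),
        torusInt_congr fun z hz =>
          circleAverage_normIntegrand_cons lam hlam.1 h0 ha hb hc hd ht hz,
        ih (Fin.tail lam) ⟨fun i => hlam.1 _, fun i j hij => hlam.2 _ _ (Fin.succ_le_succ_iff.mpr hij)⟩]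
      congr 1
      rw [Fin.card_filter_univ_succ, if_neg h0.ne']
      rfl
    · have hzero : ∀ i, lam i = 0 := fun i =>
        le_antisymm ((hlam.2 0 i (Fin.zero_le i)).trans (not_lt.mp h0)) (hlam.1 i)
      have hcard : (univ.filter fun i : Fin (n + 1) => lam i = 0).card = n + 1 := by
        simp [hzero]
      have hfun : normIntegrand (n + 1) lam t a b c d = nsDensity (n + 1) t a b c d := by
        ext z
        simp [normIntegrand, Epoly, hzero]
      rw [hcard, hfun, torusInt_nsDensity (n + 1) ha hb ht hc hd]
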